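/- For all n ≥ 1, b(2n, n−1) = p(2n, n−1) = (1/2)·Σ_{k odd, 1 ≤ k ≤ 2n−1} C(2n,k)·EC((k−1)/2)·EC((2n−k−1)/2), where C(2n,k) denotes the binomial coefficient. -/

import Mathlib

open Finset
open scoped Classical

/-- The one-line word of a permutation of `Fin n`, with values in `{1, …, n}`. -/
def permWord {n : ℕ} (π : Equiv.Perm (Fin n)) : List ℕ :=
  (List.finRange n).map fun i => (π i : ℕ) + 1

/-- The set of (0-indexed) ascent positions of a word. Position `i` (for
`0 ≤ i ≤ length - 2`) is an ascent if `w_i < w_{i+1}`. -/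
def ascentSet (w : List ℕ) : Finset ℕ :=
  (Finset.range (w.length - 1)).filter fun i => w.getD i 0 < w.getD (i + 1) 0

/-- The set of (0-indexed) descent positions of a word. Position `i` (for
`0 ≤ i ≤ length - 2`) is a descent if `w_i > w_{i+1}`. -/
def descentSet (w : List ℕ) : Finset ℕ :=
  (Finset.range (w.length - 1)).filter fun i => w.getD (i + 1) 0 < w.getD i 0

/-- The number of descents of a permutation. -/
def descentCount {n : ℕ} (π : Equiv.Perm (Fin n)) : ℕ :=
  (descentSet (permWord π)).card

/-- A permutation is ballot if every prefix of its one-line notation has at least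
as many ascents as descents. -/
def IsBallot {n : ℕ} (π : Equiv.Perm (Fin n)) : Prop :=
  ∀ k, k ≤ n →
    (descentSet ((permWord π).take k)).card ≤ (ascentSet ((permWord π).take k)).card

/-- The Eulerian number `E(n,d)`: the number of permutations of `{1,…,n}` with
exactly `d` descents.  (`E(0,0) = 1` and `E(0,d) = 0` for `d ≥ 1`.) -/
noncomputable def eulerianNum (n d : ℕ) : ℕ :=
  (Finset.univ.filter fun π : Equiv.Perm (Fin n) => descentCount π = d).card

/-- `M(c)` for a cycle `c`: the minimum of the number of cyclic ascents and the
number of cyclic descents of `c`. -/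
noncomputable def cycleM {n : ℕ} (c : Equiv.Perm (Fin n)) : ℕ :=
  min ((c.support.filter fun x => x < c x).card) ((c.support.filter fun x => c x < x).card)

/-- `M(π)`: the sum of `M(c)` over the cycles `c` of the cycle decomposition of `π`
(fixed points contribute `0`). -/
noncomputable def permM {n : ℕ} (π : Equiv.Perm (Fin n)) : ℕ :=
  ∑ c ∈ π.cycleFactorsFinset, cycleM c

/-- The number of ballot permutations of `{1,…,n}`. -/
noncomputable def ballotTotal (n : ℕ) : ℕ :=
  (Finset.univ.filter fun π : Equiv.Perm (Fin n) => IsBallot π).card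

/-- The number of permutations of `{1,…,n}` of odd order. -/
noncomputable def oddOrderTotal (n : ℕ) : ℕ :=
  (Finset.univ.filter fun π : Equiv.Perm (Fin n) => Odd (orderOf π)).card

/-- `b(n,d)`: the number of ballot permutations of `{1,…,n}` with exactly `d` descents. -/
noncomputable def bCount (n d : ℕ) : ℕ :=
  (Finset.univ.filter fun π : Equiv.Perm (Fin n) => IsBallot π ∧ descentCount π = d).card

/-- `p(n,d)`: the number of odd order permutations `π` of `{1,…,n}` with `M(π) = d`. -/
noncomputable def pCount (n d : ℕ) : ℕ :=
  (Finset.univ.filter fun π : Equiv.Perm (Fin n) => Odd (orderOf π) ∧ permM π = d).card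

/-- The Eulerian–Catalan numbers: `EC(n) = 2·E(2n, n-1)`, with `EC(0) = 1`. -/
noncomputable def eulerianCatalan (n : ℕ) : ℕ :=
  if n = 0 then 1 else 2 * eulerianNum (2 * n) (n - 1)

section Words

variable {α β : Type*} [LinearOrder α] [LinearOrder β]

/-- The step from the letter `a` to the letter `b`: `1` for an ascent, `-1` otherwise. -/
def stepSign (a b : α) : ℤ := if a < b then 1 else -1

/-- The list of steps between consecutive letters of a word. -/
def steps (w : List α) : List ℤ := List.zipWith stepSign w w.tail

/-- The list of steps between cyclically consecutive letters of a word. -/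
def cyclicSteps : List α → List ℤ
  | [] => []
  | a :: l => steps (a :: l ++ [a])

/-- A list of integers is ballot if all its prefix sums are nonnegative. -/
def BallotSteps (l : List ℤ) : Prop := ∀ p, p <+: l → 0 ≤ p.sum

/-- A word is Dyck if its list of steps is ballot and sums to zero. -/
def IsDyckWord (w : List α) : Prop := BallotSteps (steps w) ∧ (steps w).sum = 0

theorem stepSign_eq_or (a b : α) : stepSign a b = 1 ∨ stepSign a b = -1 := by
  unfold stepSign; split_ifs <;> simp

theorem stepSign_swap {a b : α} (h : a ≠ b) : stepSign b a = -stepSign a b := by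
  unfold stepSign
  rcases lt_or_gt_of_ne h with h | h <;> simp [h, h.not_gt]

@[simp] theorem steps_nil : steps ([] : List α) = [] := rfl

@[simp] theorem steps_singleton (a : α) : steps [a] = [] := rfl

@[simp] theorem steps_cons_cons (a b : α) (l : List α) :
    steps (a :: b :: l) = stepSign a b :: steps (b :: l) := rfl

@[simp] theorem length_steps (w : List α) : (steps w).length = w.length - 1 := by
  simp [steps]

theorem steps_append_cons (u : List α) (a : α) (v : List α) :
    steps (u ++ a :: v) = steps (u ++ [a]) ++ steps (a :: v) := by
  induction u with
  | nil => simp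
  | cons b u ih => cases u <;> simp_all

theorem steps_append_cons_cons (u : List α) (a b : α) (v : List α) :
    steps (u ++ a :: b :: v) = steps (u ++ [a]) ++ stepSign a b :: steps (b :: v) := by
  rw [steps_append_cons, steps_cons_cons]

theorem steps_map {f : α → β} (hf : StrictMono f) (w : List α) :
    steps (w.map f) = steps w := by
  have h : ∀ a b, stepSign (f a) (f b) = stepSign a b := fun a b => by
    simp only [stepSign, hf.lt_iff_lt]
  simp [steps, ← List.map_tail, List.zipWith_map, h]

theorem steps_take (w : List α) (k : ℕ) : steps (w.take k) = (steps w).take (k - 1) := by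
  induction w generalizing k with
  | nil => simp
  | cons a w ih =>
    rcases k with _ | _ | k
    · simp
    · simp
    · cases w with
      | nil => simp
      | cons b w => simpa using ih (k + 1)

theorem steps_reverse {w : List α} (hw : w.Nodup) :
    steps w.reverse = ((steps w).map Neg.neg).reverse := by
  induction w with
  | nil => simp
  | cons a w ih =>
    cases w with
    | nil => simp
    | cons b w =>
      have hab : a ≠ b := by rintro rfl; simp at hw
      have := ih hw.of_cons
      simp only [List.reverse_cons] at this
      simp only [List.reverse_cons, List.append_assoc, List.singleton_append,
        steps_append_cons_cons, this, steps_cons_cons, List.map_cons, stepSign_swap hab,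
        steps_singleton]

theorem eq_one_or_of_mem_steps {w : List α} {x : ℤ} (hx : x ∈ steps w) : x = 1 ∨ x = -1 := by
  induction w with
  | nil => simp at hx
  | cons a w ih =>
    cases w with
    | nil => simp at hx
    | cons b w =>
      rcases List.mem_cons.1 hx with rfl | hx
      · exact stepSign_eq_or a b
      · exact ih hx

theorem BallotSteps.sum_nonneg {l : List ℤ} (h : BallotSteps l) : 0 ≤ l.sum :=
  h l List.prefix_rfl

theorem BallotSteps.of_append {l m : List ℤ} (h : BallotSteps (l ++ m)) : BallotSteps l :=
  fun p hp => h p (hp.trans (List.prefix_append l m))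

theorem BallotSteps.append {l m : List ℤ} (hl : BallotSteps l)
    (hm : ∀ p, p <+: m → 0 ≤ l.sum + p.sum) : BallotSteps (l ++ m) := by
  rintro p ⟨t, ht⟩
  rcases List.append_eq_append_iff.1 ht with ⟨c, rfl, -⟩ | ⟨c, rfl, rfl⟩
  · exact hl p (List.prefix_append _ _)
  · simpa using hm c (List.prefix_append _ _)

theorem ballotSteps_nil : BallotSteps [] := by
  intro p hp
  simp [List.prefix_nil.1 hp]

theorem ballotSteps_iff_take {l : List ℤ} :
    BallotSteps l ↔ ∀ k, 0 ≤ (l.take k).sum := by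
  constructor
  · intro h k
    exact h _ (List.take_prefix k l)
  · intro h p hp
    rw [List.prefix_iff_eq_take.1 hp]
    exact h _

theorem BallotSteps.reverse_neg {l : List ℤ} (h : BallotSteps l) (h0 : l.sum = 0) :
    BallotSteps (l.map Neg.neg).reverse := by
  intro p hp
  obtain ⟨t, ht⟩ := hp
  have h1 : l.map Neg.neg = t.reverse ++ p.reverse := by
    rw [← List.reverse_append, ht, List.reverse_reverse]
  have h2 : l = t.reverse.map Neg.neg ++ p.reverse.map Neg.neg := by
    rw [← List.map_append, ← h1]; simp
  have h3 := h (t.reverse.map Neg.neg) ⟨_, h2.symm⟩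
  have h4 : (p.reverse.map Neg.neg).sum = -p.sum := by
    rw [← List.sum_neg]; simp
  rw [h2, List.sum_append, h4] at h0
  lia

theorem IsDyckWord.reverse {w : List α} (hn : w.Nodup) (h : IsDyckWord w) :
    IsDyckWord w.reverse := by
  rw [IsDyckWord, steps_reverse hn]
  refine ⟨h.1.reverse_neg h.2, ?_⟩
  rw [List.sum_reverse, ← List.sum_neg, h.2, neg_zero]

/-- A ballot list of `±1` steps with positive sum splits at its last departure from zero. -/
theorem BallotSteps.exists_split {l : List ℤ} (hl : ∀ x ∈ l, x ≤ 1) (h : BallotSteps l)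
    (hs : 1 ≤ l.sum) : ∃ a b, l = a ++ 1 :: b ∧ a.sum = 0 ∧ BallotSteps b := by
  induction l using List.reverseRecOn with
  | nil => simp at hs
  | append_singleton l x ih =>
    have hx : x ≤ 1 := hl x (by simp)
    rw [List.sum_append, List.sum_singleton] at hs
    by_cases h1 : 1 ≤ l.sum
    · obtain ⟨a, b, rfl, ha, hb⟩ := ih (fun y hy => hl y (by simp [hy])) h.of_append h1
      refine ⟨a, b ++ [x], by simp, ha, hb.append fun p hp => ?_⟩
      rcases List.prefix_cons_iff.1 hp with rfl | ⟨t, rfl, ht⟩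
      · simpa using hb.sum_nonneg
      · simp only [List.prefix_nil.1 ht]
        simp at hs ⊢
        lia
    · have := h.of_append.sum_nonneg
      obtain rfl : x = 1 := by lia
      exact ⟨l, [], rfl, by lia, ballotSteps_nil⟩

theorem split_unique {a b a' b' : List ℤ} (h : a ++ 1 :: b = a' ++ 1 :: b') (ha : a.sum = 0)
    (hb : BallotSteps b) (ha' : a'.sum = 0) (hb' : BallotSteps b') : a = a' := by
  have key : ∀ a b a' b' c : List ℤ, a' = a ++ c → 1 :: b = c ++ 1 :: b' → a.sum = 0 →
      BallotSteps b → a'.sum = 0 → a = a' := by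
    rintro a b a' b' (_ | ⟨x, c⟩) rfl h ha hb ha'
    · simp
    · simp only [List.cons_append, List.cons.injEq] at h
      obtain ⟨rfl, rfl⟩ := h
      have := hb.of_append.sum_nonneg
      simp at ha'
      lia
  rcases List.append_eq_append_iff.1 h with ⟨c, h1, h2⟩ | ⟨c, h1, h2⟩
  · exact key a b a' b' c h1 h2 ha hb ha'
  · exact (key a' b' a b c h1 h2 ha' hb' ha).symm

/-- Splitting a list of integers at the first minimum of its prefix sums. -/
theorem exists_min_split (l : List ℤ) :
    ∃ a b, l = a ++ b ∧ BallotSteps b ∧ ∀ s, s ≠ [] → s <:+ a → s.sum < 0 := by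
  induction l with
  | nil =>
    exact ⟨[], [], rfl, ballotSteps_nil, fun s hs h => absurd (List.suffix_nil.1 h) hs⟩
  | cons x l ih =>
    obtain ⟨a, b, rfl, hb, ha⟩ := ih
    by_cases hx : x + a.sum < 0
    · refine ⟨x :: a, b, rfl, hb, fun s hs h => ?_⟩
      rcases List.suffix_cons_iff.1 h with rfl | h
      · simpa using hx
      · exact ha s hs h
    · refine ⟨[], x :: a ++ b, rfl, BallotSteps.append ?_ ?_, fun s hs h =>
        absurd (List.suffix_nil.1 h) hs⟩
      · intro p hp
        rcases List.prefix_cons_iff.1 hp with rfl | ⟨t, rfl, s, rfl⟩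
        · simp
        · by_cases hs : s = []
          · subst hs; simp at hx ⊢; lia
          · have := ha s hs (List.suffix_append _ _)
            simp at hx ⊢; lia
      · intro p hp
        have := hb p hp
        simp; lia

theorem cyclicSteps_append_cons (a b : α) (p q : List α) :
    cyclicSteps (a :: p ++ b :: q) = steps (a :: p ++ [b]) ++ steps (b :: q ++ [a]) := by
  have := steps_append_cons (a :: p) b (q ++ [a])
  simpa [cyclicSteps] using this

theorem exists_append_of_isRotated {γ : Type*} {x y : List γ} (h : x ~r y) :
    ∃ p q, x = p ++ q ∧ y = q ++ p := by
  obtain ⟨n, hn, rfl⟩ := List.isRotated_iff_mod.1 h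
  exact ⟨x.take n, x.drop n, by simp, List.rotate_eq_drop_append_take hn⟩

theorem sum_cyclicSteps_of_isRotated {x y : List α} (h : x ~r y) :
    (cyclicSteps x).sum = (cyclicSteps y).sum := by
  obtain ⟨p, q, rfl, rfl⟩ := exists_append_of_isRotated h
  rcases p with _ | ⟨a, p⟩
  · simp
  rcases q with _ | ⟨b, q⟩
  · simp
  rw [cyclicSteps_append_cons, cyclicSteps_append_cons, List.sum_append, List.sum_append, add_comm]

theorem exists_cyclicSteps_eq_append {w : List α} (hw : w ≠ []) :
    ∃ x : ℤ, (x = 1 ∨ x = -1) ∧ cyclicSteps w = steps w ++ [x] := by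
  rcases w with _ | ⟨a, l⟩
  · exact absurd rfl hw
  rcases List.eq_nil_or_concat' l with rfl | ⟨l, b, rfl⟩
  · exact ⟨_, stepSign_eq_or a a, rfl⟩
  · refine ⟨_, stepSign_eq_or b a, ?_⟩
    simpa [cyclicSteps] using steps_append_cons_cons (a :: l) b a []

theorem sum_cyclicSteps_reverse {w : List α} (hn : w.Nodup) (h : 2 ≤ w.length) :
    (cyclicSteps w.reverse).sum = -(cyclicSteps w).sum := by
  rcases w with _ | ⟨a, l⟩
  · simp at h
  rcases List.eq_nil_or_concat' l with rfl | ⟨l, b, rfl⟩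
  · simp at h
  have hab : a ≠ b := by rintro rfl; simp at hn
  have h1 : cyclicSteps (a :: (l ++ [b])) = steps (a :: (l ++ [b])) ++ [stepSign b a] := by
    simpa [cyclicSteps] using steps_append_cons_cons (a :: l) b a []
  have h2 : cyclicSteps (a :: (l ++ [b])).reverse =
      steps (a :: (l ++ [b])).reverse ++ [stepSign a b] := by
    simpa [cyclicSteps] using steps_append_cons_cons (b :: l.reverse) a b []
  rw [h1, h2, steps_reverse hn, List.sum_append, List.sum_append, List.sum_reverse,
    ← List.sum_neg, stepSign_swap hab]
  simp; ring

theorem IsDyckWord.natAbs_sum_cyclicSteps {w : List α} (h : IsDyckWord w) (hw : w ≠ []) :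
    (cyclicSteps w).sum.natAbs = 1 := by
  obtain ⟨x, hx, h1⟩ := exists_cyclicSteps_eq_append hw
  rw [h1, List.sum_append, h.2]
  rcases hx with rfl | rfl <;> simp

/-- Uniqueness part of the cycle lemma: rotated Dyck words are equal. -/
theorem IsDyckWord.eq_of_isRotated {x y : List α} (hx : IsDyckWord x) (hy : IsDyckWord y)
    (h : x ~r y) : x = y := by
  obtain ⟨p, q, rfl, rfl⟩ := exists_append_of_isRotated h
  rcases List.eq_nil_or_concat' p with rfl | ⟨p, a, rfl⟩
  · simp
  rcases List.eq_nil_or_concat' q with rfl | ⟨q, b, rfl⟩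
  · simp
  obtain ⟨a', p', hp⟩ : ∃ a' p', p ++ [a] = a' :: p' := by cases p <;> simp
  obtain ⟨b', q', hq⟩ : ∃ b' q', q ++ [b] = b' :: q' := by cases q <;> simp
  have h1 := steps_append_cons_cons p a b' q'
  have h2 := steps_append_cons_cons q b a' p'
  rw [IsDyckWord, List.append_assoc, List.singleton_append, hq, h1, hp] at hx
  rw [IsDyckWord, List.append_assoc, List.singleton_append, hp, h2, hq] at hy
  have e1 := hx.1 (steps (a' :: p') ++ [stepSign a b']) ⟨steps (b' :: q'), by simp⟩
  have e2 := hy.1 (steps (b' :: q') ++ [stepSign b a']) ⟨steps (a' :: p'), by simp⟩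
  have e3 := hx.1.of_append.sum_nonneg
  have e4 := hy.1.of_append.sum_nonneg
  have e5 := hx.2
  have e6 := hy.2
  simp only [List.sum_append, List.sum_cons, List.sum_nil] at e1 e2 e5 e6
  rcases stepSign_eq_or a b' with h | h <;> rcases stepSign_eq_or b a' with h' | h' <;> lia

theorem exists_isDyckWord_of_sum_eq_neg_one {x : List α} (h : (cyclicSteps x).sum = -1) :
    ∃ y, x ~r y ∧ IsDyckWord y := by
  obtain ⟨a, b, hab, hb, ha⟩ := exists_min_split (cyclicSteps x)
  have hx : x ≠ [] := by rintro rfl; simp [cyclicSteps] at h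
  have hrot : ∃ y, x ~r y ∧ cyclicSteps y = b ++ a := by
    have hlen : (cyclicSteps x).length = x.length := by
      obtain ⟨_, -, h⟩ := exists_cyclicSteps_eq_append hx
      have := List.length_pos_iff.2 hx
      simp [h]; lia
    have hsplit : x = x.take a.length ++ x.drop a.length := by simp
    have hlp : (x.take a.length).length = a.length := by
      rw [List.length_take, ← hlen, hab]; simp
    generalize x.take a.length = p at hsplit hlp
    generalize x.drop a.length = q at hsplit
    subst hsplit
    refine ⟨q ++ p, List.isRotated_append, ?_⟩
    rcases p with _ | ⟨c, p⟩
    · obtain rfl : a = [] := List.length_eq_zero_iff.1 hlp.symm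
      simpa using hab
    rcases q with _ | ⟨d, q⟩
    · have : b = [] := by
        rw [hab] at hlen
        simp at hlen hlp
        exact List.length_eq_zero_iff.1 (by lia)
      subst this
      simpa using hab
    rw [cyclicSteps_append_cons] at hab ⊢
    obtain ⟨h1, h2⟩ := List.append_inj hab (by simpa using hlp)
    rw [h1, h2]
  obtain ⟨y, hy, hyc⟩ := hrot
  refine ⟨y, hy, ?_⟩
  have hy0 : y ≠ [] := by
    rintro rfl
    exact hx (List.isRotated_nil_iff.1 hy)
  have hsum : a.sum + b.sum = -1 := by rw [← List.sum_append, ← hab, h]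
  obtain ⟨s, hs, hys⟩ := exists_cyclicSteps_eq_append hy0
  rcases List.eq_nil_or_concat' a with rfl | ⟨a, t, rfl⟩
  · have := hb.sum_nonneg
    simp at hsum; lia
  have heq : steps y = b ++ a ∧ s = t := by
    rw [hyc, ← List.append_assoc] at hys
    have := List.append_inj' hys rfl
    simpa [eq_comm] using this
  have hlt : t < 0 := by simpa using ha [t] (by simp) (List.suffix_append _ _)
  obtain rfl : t = -1 := by have := heq.2; lia
  simp only [List.sum_append, List.sum_singleton] at hsum
  refine ⟨?_, by rw [heq.1, List.sum_append]; lia⟩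
  rw [heq.1]
  refine hb.append ?_
  rintro p ⟨r, rfl⟩
  have := ha (r ++ [-1]) (by simp) ⟨p, by simp⟩
  simp only [List.sum_append, List.sum_singleton] at hsum this
  lia

/-- Existence part of the cycle lemma. -/
theorem exists_isDyckWord_of_natAbs_sum {x : List α} (hn : x.Nodup)
    (h : (cyclicSteps x).sum.natAbs = 1) : ∃ y, x ~r y ∧ IsDyckWord y := by
  rcases Int.natAbs_eq_iff.1 h with h | h
  · have hlen : 2 ≤ x.length := by
      rcases x with _ | ⟨a, _ | ⟨b, x⟩⟩
      · simp [cyclicSteps] at h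
      · simp [cyclicSteps, stepSign] at h
      · simp
    obtain ⟨y, hy, hd⟩ := exists_isDyckWord_of_sum_eq_neg_one
      (x := x.reverse) (by rw [sum_cyclicSteps_reverse hn hlen, h]; rfl)
    have hyn : y.Nodup := hy.nodup_iff.1 (List.nodup_reverse.2 hn)
    exact ⟨y.reverse, List.isRotated_reverse_comm_iff.1 hy, hd.reverse hyn⟩
  · exact exists_isDyckWord_of_sum_eq_neg_one h

/-- The words that use each letter of `S` exactly once and no other letter. -/
def words {γ : Type*} (S : Finset γ) : Finset (List γ) := ⟨S.val.lists, Multiset.lists_nodup_finset S⟩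

theorem mem_words {γ : Type*} {S : Finset γ} {w : List γ} : w ∈ words S ↔ w.Nodup ∧ ∀ x, x ∈ w ↔ x ∈ S := by
  have h : w ∈ words S ↔ S.val = ↑w := Multiset.mem_lists_iff _ _
  rw [h]
  constructor
  · intro h
    exact ⟨Multiset.coe_nodup.1 (h ▸ S.nodup), fun x => by rw [← Finset.mem_val, h]; rfl⟩
  · rintro ⟨hn, hx⟩
    exact (Multiset.Nodup.ext S.nodup (Multiset.coe_nodup.2 hn)).2 fun x => (hx x).symm

theorem length_of_mem_words {S : Finset α} {w : List α} (hw : w ∈ words S) :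
    w.length = S.card := by
  obtain ⟨hn, hx⟩ := mem_words.1 hw
  rw [← List.toFinset_card_of_nodup hn]
  congr 1
  ext x
  simp [hx]

theorem reverse_mem_words {γ : Type*} {S : Finset γ} {w : List γ} (hw : w ∈ words S) :
    w.reverse ∈ words S := by
  simpa [mem_words] using hw

theorem mem_words_of_isRotated {γ : Type*} {S : Finset γ} {w w' : List γ} (hw : w ∈ words S) (h : w ~r w') :
    w' ∈ words S := by
  rw [mem_words] at hw ⊢
  exact ⟨h.nodup_iff.1 hw.1, fun x => by rw [← h.mem_iff, hw.2]⟩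

/-- The Dyck words that use each letter of `S` exactly once and no other letter. -/
noncomputable def dyckWords (S : Finset α) : Finset (List α) := (words S).filter IsDyckWord

theorem mem_dyckWords {S : Finset α} {w : List α} :
    w ∈ dyckWords S ↔ w ∈ words S ∧ IsDyckWord w := by
  simp [dyckWords]

theorem reverse_mem_dyckWords {S : Finset α} {w : List α} (hw : w ∈ dyckWords S) :
    w.reverse ∈ dyckWords S := by
  rw [mem_dyckWords] at hw ⊢
  exact ⟨reverse_mem_words hw.1, hw.2.reverse (mem_words.1 hw.1).1⟩

theorem card_le_card_of_equivalence {γ : Type*} {A B : Finset γ} {r : γ → γ → Prop}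
    (hr : Equivalence r) (hA : ∀ a ∈ A, ∃ b ∈ B, r a b)
    (uA : ∀ a ∈ A, ∀ a' ∈ A, r a a' → a = a') : A.card ≤ B.card := by
  choose! f hf hrf using hA
  refine Finset.card_le_card_of_injOn f hf fun a ha a' ha' h => uA a ha a' ha' ?_
  exact hr.trans (hrf a ha) (h ▸ hr.symm (hrf a' ha'))

theorem sum_cyclicSteps_concat_max {u : List α} {m : α} (hu : u ≠ []) (hm : ∀ x ∈ u, x < m) :
    (cyclicSteps (u ++ [m])).sum = (steps u).sum := by
  rcases u with _ | ⟨a, u⟩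
  · exact absurd rfl hu
  have ha : stepSign m a = -1 := by simp [stepSign, (hm a (by simp)).le]
  have h1 : cyclicSteps (a :: u ++ [m]) = steps (a :: u ++ [m]) ++ [stepSign m a] := by
    simpa [cyclicSteps] using steps_append_cons_cons (a :: u) m a []
  have h2 : (steps (a :: u ++ [m])).sum = (steps (a :: u)).sum + 1 := by
    obtain ⟨l, b, hl⟩ : ∃ l b, a :: u = l ++ [b] :=
      (List.eq_nil_or_concat' (a :: u)).resolve_left (by simp)
    have hb : stepSign b m = 1 := by simp [stepSign, hm b (by simp [hl])]
    rw [hl, List.append_assoc, List.singleton_append, steps_append_cons_cons, hb]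
    simp
  rw [h1, List.sum_append, h2, ha]
  simp

theorem card_dyckWords_eq_card_balanced {S : Finset α} (hS : 2 ≤ S.card) {m : α} (hm : m ∈ S)
    (hmax : ∀ x ∈ S, x ≤ m) :
    (dyckWords S).card =
      ((words (S.erase m)).filter fun u => (steps u).sum.natAbs = 1).card := by
  have hB : ((words (S.erase m)).filter fun u => (steps u).sum.natAbs = 1).card =
      (((words (S.erase m)).filter fun u => (steps u).sum.natAbs = 1).image (· ++ [m])).card :=
    (Finset.card_image_of_injective _ (List.append_left_injective [m])).symm
  have hmem : ∀ u, u ++ [m] ∈ words S ↔ u ∈ words (S.erase m) := by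
    intro u
    simp only [mem_words, Finset.mem_erase, List.nodup_append, List.mem_append,
      List.mem_singleton]
    constructor
    · rintro ⟨⟨hn, -, hd⟩, hx⟩
      refine ⟨hn, fun x => ⟨fun h => ⟨hd x h m rfl, (hx x).1 (Or.inl h)⟩, fun h => ?_⟩⟩
      exact ((hx x).2 h.2).resolve_right h.1
    · rintro ⟨hn, hx⟩
      refine ⟨⟨hn, List.nodup_singleton m, fun x h y hy => hy ▸ ((hx x).1 h).1⟩, fun x => ?_⟩
      by_cases hxm : x = m
      · simp [hxm, hm]
      · simp [hxm, hx]
  have hsum : ∀ u ∈ words (S.erase m), (cyclicSteps (u ++ [m])).sum = (steps u).sum := by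
    intro u hu
    apply sum_cyclicSteps_concat_max
    · rintro rfl
      have := length_of_mem_words hu
      rw [Finset.card_erase_of_mem hm] at this
      simp at this; lia
    · intro x hx
      have := ((mem_words.1 hu).2 x).1 hx
      rw [Finset.mem_erase] at this
      exact lt_of_le_of_ne (hmax x this.2) this.1
  rw [hB]
  apply le_antisymm
  · refine card_le_card_of_equivalence List.IsRotated.eqv ?_ ?_
    · intro w hw
      obtain ⟨hw, hd⟩ := mem_dyckWords.1 hw
      obtain ⟨p, q, rfl⟩ := List.append_of_mem (((mem_words.1 hw).2 m).2 hm)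
      have hrot : p ++ m :: q ~r (q ++ p) ++ [m] := by
        have := List.isRotated_append (l := p ++ [m]) (l' := q)
        simpa using this
      have hw' := (hmem _).1 (mem_words_of_isRotated hw hrot)
      refine ⟨_, Finset.mem_image_of_mem _ (Finset.mem_filter.2 ⟨hw', ?_⟩), hrot⟩
      rw [← hsum _ hw', ← sum_cyclicSteps_of_isRotated hrot]
      exact hd.natAbs_sum_cyclicSteps (by simp)
    · intro w hw w' hw' h
      exact (mem_dyckWords.1 hw).2.eq_of_isRotated (mem_dyckWords.1 hw').2 h
  · refine card_le_card_of_equivalence List.IsRotated.eqv ?_ ?_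
    · intro w hw
      obtain ⟨u, hu, rfl⟩ := Finset.mem_image.1 hw
      obtain ⟨hu, hs⟩ := Finset.mem_filter.1 hu
      have hw := (hmem u).2 hu
      obtain ⟨y, hy, hd⟩ := exists_isDyckWord_of_natAbs_sum (x := u ++ [m]) (mem_words.1 hw).1
        (by rw [hsum u hu, hs])
      exact ⟨y, mem_dyckWords.2 ⟨mem_words_of_isRotated hw hy, hd⟩, hy⟩
    · intro w hw w' hw' h
      obtain ⟨u, hu, rfl⟩ := Finset.mem_image.1 hw
      obtain ⟨u', hu', rfl⟩ := Finset.mem_image.1 hw'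
      have hn := (mem_words.1 ((hmem u).2 (Finset.mem_filter.1 hu).1)).1
      obtain ⟨p, q, h1, h2⟩ := exists_append_of_isRotated h
      rcases List.eq_nil_or_concat' p with rfl | ⟨p, a, rfl⟩
      · simp_all
      rcases List.eq_nil_or_concat' q with rfl | ⟨q, b, rfl⟩
      · simp_all
      rw [h1] at hn
      rw [← List.append_assoc] at h1 h2
      have ha := List.append_inj' h2 rfl
      have hb := List.append_inj' h1 rfl
      simp only [List.cons.injEq, and_true] at ha hb
      obtain ⟨-, rfl⟩ := ha
      obtain ⟨-, rfl⟩ := hb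
      simp [List.nodup_append] at hn

theorem card_filter_natAbs_eq_two_mul (S : Finset α) :
    ((words S).filter fun u => (steps u).sum.natAbs = 1).card =
      2 * ((words S).filter fun u => (steps u).sum = 1).card := by
  have hrev : ∀ u ∈ words S, (steps u.reverse).sum = -(steps u).sum := by
    intro u hu
    rw [steps_reverse (mem_words.1 hu).1, List.sum_reverse, ← List.sum_neg]
  have hneg : ((words S).filter fun u => (steps u).sum = -1).card =
      ((words S).filter fun u => (steps u).sum = 1).card := by
    refine Finset.card_nbij' List.reverse List.reverse ?_ ?_
      (fun u _ => u.reverse_reverse) (fun u _ => u.reverse_reverse)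
    all_goals
      intro u hu
      rw [Finset.mem_coe, Finset.mem_filter] at hu ⊢
      exact ⟨reverse_mem_words hu.1, by simp [hrev u hu.1, hu.2]⟩
  rw [two_mul]
  nth_rewrite 1 [← hneg]
  rw [← Finset.card_union_of_disjoint, ← Finset.filter_or]
  · congr 1
    apply Finset.filter_congr
    intro u _
    rw [Int.natAbs_eq_iff]
    simp [or_comm]
  · rw [Finset.disjoint_filter]
    intro u _ h h'
    lia

theorem card_filter_words_eq_card_perm {S : Finset α} {k : ℕ} (hS : S.card = k)
    (P : List ℤ → Prop) [DecidablePred P] :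
    ((words S).filter fun w => P (steps w)).card =
      (Finset.univ.filter fun π : Equiv.Perm (Fin k) => P (steps (List.ofFn π))).card := by
  set e := S.orderEmbOfFin hS with he
  symm
  refine Finset.card_bij (fun π _ => (List.ofFn π).map e) ?_ ?_ ?_
  · intro π hπ
    rw [Finset.mem_filter, steps_map e.strictMono, mem_words]
    refine ⟨⟨?_, fun x => ?_⟩, (Finset.mem_filter.1 hπ).2⟩
    · exact (List.nodup_ofFn.2 π.injective).map e.injective
    · rw [← Finset.mem_coe, ← Finset.range_orderEmbOfFin S hS]
      simp only [List.mem_map, List.mem_ofFn, exists_exists_eq_and, Set.mem_range]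
      exact ⟨fun ⟨a, h⟩ => ⟨π a, h⟩, fun ⟨a, h⟩ => ⟨π.symm a, by simpa using h⟩⟩
  · intro π _ π' _ h
    have := List.map_injective_iff.2 e.injective h
    exact Equiv.coe_fn_injective (List.ofFn_injective this)
  · intro w hw
    obtain ⟨hw, hP⟩ := Finset.mem_filter.1 hw
    have hlen : w.length = k := (length_of_mem_words hw).trans hS
    subst hlen
    have hex : ∀ i : Fin w.length, ∃ j, e j = w.get i := by
      intro i
      have : w.get i ∈ (S : Set α) := ((mem_words.1 hw).2 _).1 (List.get_mem w i)
      rwa [← Finset.range_orderEmbOfFin S hS] at this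
    choose f hf using hex
    have hinj : Function.Injective f := by
      intro i j hij
      apply (List.nodup_iff_injective_get.1 (mem_words.1 hw).1)
      rw [← hf, ← hf, hij]
    let π : Equiv.Perm (Fin w.length) :=
      Equiv.ofBijective f (Finite.injective_iff_bijective.1 hinj)
    have hπ : (List.ofFn π).map e = w := by
      rw [List.map_ofFn]
      have : e ∘ π = w.get := funext hf
      rw [this, List.ofFn_get]
    refine ⟨π, Finset.mem_filter.2 ⟨Finset.mem_univ _, ?_⟩, hπ⟩
    rw [← steps_map e.strictMono, hπ]
    exact hP

end Words

section PermWord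

theorem sum_steps_eq_sum_range (w : List ℕ) :
    (steps w).sum =
      ∑ i ∈ Finset.range (w.length - 1), stepSign (w.getD i 0) (w.getD (i + 1) 0) := by
  induction w with
  | nil => simp
  | cons a w ih =>
    cases w with
    | nil => simp
    | cons b w =>
      simp only [List.length_cons, Nat.add_sub_cancel] at ih ⊢
      rw [Finset.sum_range_succ', steps_cons_cons, List.sum_cons, ih, add_comm]
      simp

theorem card_ascentSet_add_card_descentSet {w : List ℕ} (hw : w.Nodup) :
    (ascentSet w).card + (descentSet w).card = w.length - 1 := by
  have : descentSet w =
      (Finset.range (w.length - 1)).filter fun i => ¬ w.getD i 0 < w.getD (i + 1) 0 := by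
    apply Finset.filter_congr
    intro i hi
    rw [Finset.mem_range] at hi
    have h1 : i < w.length := by lia
    have h2 : i + 1 < w.length := by lia
    have hne : w[i] ≠ w[i + 1] := fun h => by
      have := (hw.getElem_inj_iff).1 h
      lia
    simp only [List.getD_eq_getElem?_getD, List.getElem?_eq_getElem h1,
      List.getElem?_eq_getElem h2, Option.getD_some]
    lia
  rw [this, ascentSet, Finset.card_filter_add_card_filter_not, Finset.card_range]

theorem sum_steps_eq_card_sub_card {w : List ℕ} (hw : w.Nodup) :
    (steps w).sum = (ascentSet w).card - (descentSet w).card := by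
  have h1 : (steps w).sum = 2 * (ascentSet w).card - (w.length - 1 : ℕ) := by
    have : ∀ a b : ℕ, stepSign a b = 2 * (if a < b then 1 else 0) - 1 := by
      intro a b; unfold stepSign; split_ifs <;> rfl
    simp_rw [sum_steps_eq_sum_range, this, Finset.sum_sub_distrib, ← Finset.mul_sum, ascentSet,
      Finset.card_filter]
    simp
  have := card_ascentSet_add_card_descentSet hw
  lia

variable {k : ℕ} (π : Equiv.Perm (Fin k))

theorem nodup_permWord : (permWord π).Nodup := by
  refine (List.nodup_finRange k).map fun i j h => π.injective (Fin.ext ?_)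
  simpa using h

theorem steps_permWord : steps (permWord π) = steps (List.ofFn π) := by
  have h : permWord π = (List.ofFn π).map fun x : Fin k => (x : ℕ) + 1 := by
    rw [permWord, List.map_ofFn, List.ofFn_eq_map]; rfl
  have hmono : StrictMono fun x : Fin k => (x : ℕ) + 1 := fun a b hab => Nat.succ_lt_succ hab
  rw [h, steps_map hmono]

theorem descentCount_eq_iff {d : ℕ} (hk : 0 < k) :
    descentCount π = d ↔ (steps (List.ofFn π)).sum = k - 1 - 2 * d := by
  have h1 := card_ascentSet_add_card_descentSet (nodup_permWord π)
  have h2 := sum_steps_eq_card_sub_card (nodup_permWord π)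
  have h3 : (permWord π).length = k := by simp [permWord]
  rw [steps_permWord] at h2
  rw [h3] at h1
  rw [descentCount]
  lia

theorem isBallot_iff : IsBallot π ↔ BallotSteps (steps (List.ofFn π)) := by
  have h : ∀ j, (descentSet ((permWord π).take j)).card ≤ (ascentSet ((permWord π).take j)).card ↔
      0 ≤ ((steps (List.ofFn π)).take (j - 1)).sum := by
    intro j
    rw [← steps_permWord, ← steps_take,
      sum_steps_eq_card_sub_card ((nodup_permWord π).sublist (List.take_sublist _ _))]
    lia
  rw [ballotSteps_iff_take, IsBallot]
  simp_rw [h]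
  refine ⟨fun H j => ?_, fun H j _ => H _⟩
  by_cases hj : j + 1 ≤ k
  · exact H (j + 1) hj
  · have := H k le_rfl
    rw [List.take_of_length_le (by simp)] at this
    rwa [List.take_of_length_le (by simp; lia)]

theorem bCount_eq_card_words {n : ℕ} (hn : 1 ≤ n) :
    bCount (2 * n) (n - 1) = ((words (Finset.univ : Finset (Fin (2 * n)))).filter
      fun w => BallotSteps (steps w) ∧ (steps w).sum = 1).card := by
  rw [card_filter_words_eq_card_perm (k := 2 * n) (by simp)
    (fun l => BallotSteps l ∧ l.sum = 1), bCount]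
  congr 1
  apply Finset.filter_congr
  intro π _
  rw [isBallot_iff, descentCount_eq_iff π (by lia)]
  refine and_congr_right fun _ => ?_
  push_cast [hn]
  constructor <;> intro h <;> linarith

theorem card_dyckWords {α : Type*} [LinearOrder α] {S : Finset α} {j : ℕ}
    (hS : S.card = 2 * j + 1) : (dyckWords S).card = eulerianCatalan j := by
  rcases Nat.eq_zero_or_pos j with rfl | hj
  · obtain ⟨a, rfl⟩ := Finset.card_eq_one.1 hS
    have : dyckWords {a} = {[a]} := by
      ext w
      rw [mem_dyckWords, Finset.mem_singleton]
      constructor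
      · rintro ⟨hw, -⟩
        obtain ⟨b, rfl⟩ := List.length_eq_one_iff.1 (length_of_mem_words hw)
        have := ((mem_words.1 hw).2 b).1 (by simp)
        rw [Finset.mem_singleton.1 this]
      · rintro rfl
        exact ⟨mem_words.2 (by simp), by simpa [IsDyckWord] using ballotSteps_nil⟩
    simp [this, eulerianCatalan]
  · have hne : S.Nonempty := Finset.card_pos.1 (by lia)
    rw [card_dyckWords_eq_card_balanced (by lia) (S.max'_mem hne) (fun x hx => S.le_max' x hx),
      card_filter_natAbs_eq_two_mul, eulerianCatalan, if_neg hj.ne', eulerianNum,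
      card_filter_words_eq_card_perm (k := 2 * j)
        (by rw [Finset.card_erase_of_mem (S.max'_mem hne), hS]; rfl) (fun l => l.sum = 1)]
    congr 2
    apply Finset.filter_congr
    intro π _
    rw [descentCount_eq_iff π (by lia)]
    push_cast [Nat.succ_le_of_lt hj]
    constructor <;> intro h <;> linarith

end PermWord

section DyckPairs

theorem emod_two_sum_eq {l : List ℤ} (hl : ∀ x ∈ l, x = 1 ∨ x = -1) :
    l.sum % 2 = (l.length : ℤ) % 2 := by
  induction l with
  | nil => simp
  | cons a l ih =>
    have h1 := ih fun x hx => hl x (by simp [hx])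
    have h2 := hl a (by simp)
    simp only [List.sum_cons, List.length_cons]
    push_cast
    lia

theorem exists_steps_append_eq {α : Type*} [LinearOrder α] {u v : List α} (hu : u ≠ [])
    (hv : v ≠ []) :
    ∃ s : ℤ, (s = 1 ∨ s = -1) ∧ steps (u ++ v) = steps u ++ s :: steps v := by
  rcases List.eq_nil_or_concat' u with rfl | ⟨u, a, rfl⟩
  · exact absurd rfl hu
  rcases v with _ | ⟨b, v⟩
  · exact absurd rfl hv
  exact ⟨_, stepSign_eq_or a b, by simpa using steps_append_cons_cons u a b v⟩

/-- Pairs of Dyck words on complementary sets of letters, the first of which has odd size. -/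
noncomputable def dyckPairs (N : ℕ) :
    Finset (Σ _ : Finset (Fin N), List (Fin N) × List (Fin N)) :=
  (Finset.univ.filter fun S : Finset (Fin N) => Odd S.card).sigma
    fun S => dyckWords S ×ˢ dyckWords Sᶜ

theorem mem_dyckPairs {N : ℕ} {x : Σ _ : Finset (Fin N), List (Fin N) × List (Fin N)} :
    x ∈ dyckPairs N ↔ Odd x.1.card ∧ x.2.1 ∈ dyckWords x.1 ∧ x.2.2 ∈ dyckWords x.1ᶜ := by
  simp [dyckPairs]

theorem ne_nil_of_mem_dyckPairs {n : ℕ} {S : Finset (Fin (2 * n))} {u v : List (Fin (2 * n))}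
    (h : ⟨S, u, v⟩ ∈ dyckPairs (2 * n)) : u ≠ [] ∧ v ≠ [] := by
  obtain ⟨h1, h2, h3⟩ := mem_dyckPairs.1 h
  dsimp only at h1 h2 h3
  have hu := length_of_mem_words (mem_dyckWords.1 h2).1
  have hv := length_of_mem_words (mem_dyckWords.1 h3).1
  rw [Finset.card_compl, Fintype.card_fin] at hv
  have hle : S.card ≤ 2 * n := by simpa using S.card_le_univ
  constructor <;> rintro rfl <;> rw [List.length_nil] at * <;> grind

theorem card_dyckPairs (n : ℕ) :
    (dyckPairs (2 * n)).card = ∑ k ∈ (Finset.range (2 * n)).filter (fun k => Odd k),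
      (2 * n).choose k * eulerianCatalan ((k - 1) / 2) *
        eulerianCatalan ((2 * n - k - 1) / 2) := by
  have h1 : (dyckPairs (2 * n)).card = ∑ S ∈ (Finset.univ : Finset (Fin (2 * n))).powerset,
      if Odd S.card then eulerianCatalan ((S.card - 1) / 2) *
        eulerianCatalan ((2 * n - S.card - 1) / 2) else 0 := by
    rw [dyckPairs, Finset.card_sigma, Finset.sum_filter, Finset.powerset_univ]
    refine Finset.sum_congr rfl fun S _ => ?_
    split_ifs with hS
    · have hle : S.card ≤ 2 * n := by simpa using S.card_le_univ
      have hc : Sᶜ.card = 2 * n - S.card := by simp [Finset.card_compl]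
      rw [Finset.card_product, card_dyckWords (S := S) (j := (S.card - 1) / 2) (by grind),
        card_dyckWords (S := Sᶜ) (j := (2 * n - S.card - 1) / 2) (by grind)]
    · rfl
  rw [h1, Finset.sum_powerset_apply_card (fun k => if Odd k then eulerianCatalan ((k - 1) / 2) *
        eulerianCatalan ((2 * n - k - 1) / 2) else 0), Finset.card_univ, Fintype.card_fin,
    Finset.sum_range_succ, Finset.sum_filter]
  simp [mul_assoc]

theorem sum_steps_append_of_mem_dyckPairs {n : ℕ} {S : Finset (Fin (2 * n))}
    {u v : List (Fin (2 * n))} (h : ⟨S, u, v⟩ ∈ dyckPairs (2 * n)) :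
    ∃ s : ℤ, (s = 1 ∨ s = -1) ∧ steps (u ++ v) = steps u ++ s :: steps v ∧
      (steps (u ++ v)).sum = s := by
  obtain ⟨hu, hv⟩ := ne_nil_of_mem_dyckPairs h
  obtain ⟨-, h2, h3⟩ := mem_dyckPairs.1 h
  obtain ⟨s, hs, h4⟩ := exists_steps_append_eq hu hv
  refine ⟨s, hs, h4, ?_⟩
  rw [h4, List.sum_append, List.sum_cons, (mem_dyckWords.1 h2).2.2, (mem_dyckWords.1 h3).2.2]
  simp

theorem append_mem_words_of_mem_dyckPairs {N : ℕ} {S : Finset (Fin N)} {u v : List (Fin N)}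
    (h : ⟨S, u, v⟩ ∈ dyckPairs N) : u ++ v ∈ words (Finset.univ : Finset (Fin N)) := by
  obtain ⟨-, h2, h3⟩ := mem_dyckPairs.1 h
  obtain ⟨hun, hu⟩ := mem_words.1 (mem_dyckWords.1 h2).1
  obtain ⟨hvn, hv⟩ := mem_words.1 (mem_dyckWords.1 h3).1
  dsimp only at hun hu hvn hv
  simp only [mem_words, List.nodup_append, List.mem_append, hu, hv, Finset.mem_compl]
  refine ⟨⟨hun, hvn, ?_⟩, fun x => by simp [em]⟩
  rintro a ha b hb rfl
  exact hb ha

theorem card_dyckPairs_filter_sum_eq_one (n : ℕ) :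
    ((dyckPairs (2 * n)).filter fun x => (steps (x.2.1 ++ x.2.2)).sum = 1).card =
      ((words (Finset.univ : Finset (Fin (2 * n)))).filter
        fun w => BallotSteps (steps w) ∧ (steps w).sum = 1).card := by
  refine Finset.card_bij (fun x _ => x.2.1 ++ x.2.2) ?_ ?_ ?_
  · rintro ⟨S, u, v⟩ h
    obtain ⟨h, hs⟩ := Finset.mem_filter.1 h
    refine Finset.mem_filter.2 ⟨append_mem_words_of_mem_dyckPairs h, ?_, hs⟩
    obtain ⟨-, h2, h3⟩ := mem_dyckPairs.1 h
    obtain ⟨s, -, h4, h5⟩ := sum_steps_append_of_mem_dyckPairs h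
    obtain rfl : s = 1 := h5.symm.trans hs
    dsimp only
    rw [h4]
    refine (mem_dyckWords.1 h2).2.1.append fun p hp => ?_
    rw [(mem_dyckWords.1 h2).2.2]
    rcases List.prefix_cons_iff.1 hp with rfl | ⟨t, rfl, ht⟩
    · simp
    · have := (mem_dyckWords.1 h3).2.1 t ht
      simp; lia
  · rintro ⟨S, u, v⟩ h ⟨S', u', v'⟩ h' heq
    obtain ⟨h, hs⟩ := Finset.mem_filter.1 h
    obtain ⟨h', hs'⟩ := Finset.mem_filter.1 h'
    dsimp only at heq hs hs'
    obtain ⟨-, h2, h3⟩ := mem_dyckPairs.1 h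
    obtain ⟨-, h2', h3'⟩ := mem_dyckPairs.1 h'
    obtain ⟨s, -, h4, h5⟩ := sum_steps_append_of_mem_dyckPairs h
    obtain rfl : s = 1 := h5.symm.trans hs
    obtain ⟨s, -, h4', h5'⟩ := sum_steps_append_of_mem_dyckPairs h'
    obtain rfl : s = 1 := h5'.symm.trans hs'
    rw [mem_dyckWords] at h2 h3 h2' h3'
    have hsu : steps u = steps u' :=
      split_unique (by rw [← h4, ← h4', heq]) h2.2.2 h3.2.1 h2'.2.2 h3'.2.1
    have hl := congrArg List.length hsu
    have hu := List.length_pos_iff.2 (ne_nil_of_mem_dyckPairs h).1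
    have hu' := List.length_pos_iff.2 (ne_nil_of_mem_dyckPairs h').1
    rw [length_steps, length_steps] at hl
    obtain ⟨rfl, rfl⟩ := List.append_inj heq (by lia)
    obtain rfl : S = S' := by
      ext x
      rw [← (mem_words.1 h2.1).2, (mem_words.1 h2'.1).2]
    rfl
  · intro w hw
    obtain ⟨hw, hb, hs⟩ := Finset.mem_filter.1 hw
    obtain ⟨a, b, hab, ha, hbb⟩ := hb.exists_split
      (fun x hx => by rcases eq_one_or_of_mem_steps hx with h | h <;> lia) hs.ge
    have hlen : w.length - 1 = a.length + 1 + b.length := by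
      rw [← length_steps, hab]; simp; lia
    obtain ⟨u, v, rfl, hul⟩ : ∃ u v, w = u ++ v ∧ u.length = a.length + 1 :=
      ⟨w.take (a.length + 1), w.drop (a.length + 1), by simp, by simp; lia⟩
    rw [List.length_append] at hlen
    have hu : u ≠ [] := List.length_pos_iff.1 (by lia)
    have hv : v ≠ [] := List.length_pos_iff.1 (by lia)
    obtain ⟨s, -, h4⟩ := exists_steps_append_eq hu hv
    rw [hab] at h4
    obtain ⟨rfl, h5⟩ := List.append_inj h4 (by rw [length_steps]; lia)
    obtain ⟨rfl, rfl⟩ := List.cons.inj h5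
    have hbs : (steps v).sum = 0 := by
      rw [hab, List.sum_append, List.sum_cons, ha] at hs; lia
    obtain ⟨hn, hx⟩ := mem_words.1 hw
    rw [List.nodup_append] at hn
    have hodd : Odd u.length := by
      have := emod_two_sum_eq (l := steps u) fun x => eq_one_or_of_mem_steps
      rw [ha, length_steps] at this
      grind
    refine ⟨⟨u.toFinset, u, v⟩, Finset.mem_filter.2 ⟨mem_dyckPairs.2 ⟨?_, ?_, ?_⟩, hs⟩, rfl⟩
    · rwa [List.toFinset_card_of_nodup hn.1]
    · refine mem_dyckWords.2 ⟨mem_words.2 ⟨hn.1, by simp⟩, ?_, ha⟩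
      rw [hab] at hb
      exact hb.of_append
    · refine mem_dyckWords.2 ⟨mem_words.2 ⟨hn.2.1, fun x => ?_⟩, hbb, hbs⟩
      simp only [Finset.mem_compl, List.mem_toFinset]
      have := (hx x).2 (Finset.mem_univ x)
      rw [List.mem_append] at this
      exact ⟨fun h h' => hn.2.2 x h' x h rfl, fun h => this.resolve_left h⟩

theorem card_compl_odd {n : ℕ} {S : Finset (Fin (2 * n))} (h : Odd S.card) : Odd Sᶜ.card := by
  have hle : S.card ≤ 2 * n := by simpa using S.card_le_univ
  rw [Finset.card_compl, Fintype.card_fin]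
  grind

theorem card_dyckPairs_eq_two_mul_bCount {n : ℕ} (hn : 1 ≤ n) :
    (dyckPairs (2 * n)).card = 2 * bCount (2 * n) (n - 1) := by
  rw [bCount_eq_card_words hn, ← card_dyckPairs_filter_sum_eq_one,
    ← Finset.card_filter_add_card_filter_not
      (s := dyckPairs (2 * n)) (fun x => (steps (x.2.1 ++ x.2.2)).sum = 1),
    two_mul (Finset.card _), Nat.add_left_cancel_iff]
  have hsum : ∀ x ∈ dyckPairs (2 * n), (steps (x.2.2.reverse ++ x.2.1.reverse)).sum =
      -(steps (x.2.1 ++ x.2.2)).sum := by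
    rintro ⟨S, u, v⟩ h
    dsimp only
    rw [← List.reverse_append, steps_reverse
      (mem_words.1 (append_mem_words_of_mem_dyckPairs h)).1, List.sum_reverse, ← List.sum_neg]
  have hmem : ∀ x ∈ dyckPairs (2 * n), (⟨x.1ᶜ, x.2.2.reverse, x.2.1.reverse⟩ :
      Σ _ : Finset (Fin (2 * n)), List (Fin (2 * n)) × List (Fin (2 * n))) ∈
        dyckPairs (2 * n) := by
    intro x hx
    obtain ⟨h1, h2, h3⟩ := mem_dyckPairs.1 hx
    exact mem_dyckPairs.2 ⟨card_compl_odd h1, reverse_mem_dyckWords h3,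
      by simpa using reverse_mem_dyckWords h2⟩
  refine Finset.card_nbij' (fun x => ⟨x.1ᶜ, x.2.2.reverse, x.2.1.reverse⟩)
    (fun x => ⟨x.1ᶜ, x.2.2.reverse, x.2.1.reverse⟩) ?_ ?_ (fun x _ => by simp) (fun x _ => by simp)
  · intro x hx
    rw [Finset.mem_coe, Finset.mem_filter] at hx ⊢
    refine ⟨hmem x hx.1, ?_⟩
    dsimp only
    obtain ⟨s, hs, -, h⟩ := sum_steps_append_of_mem_dyckPairs hx.1
    have := hx.2
    rw [hsum x hx.1]
    lia
  · intro x hx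
    rw [Finset.mem_coe, Finset.mem_filter] at hx ⊢
    refine ⟨hmem x hx.1, ?_⟩
    dsimp only
    rw [hsum x hx.1, hx.2]
    decide

end DyckPairs

section OddOrder

open Equiv.Perm

variable {N : ℕ}

theorem cyclicSteps_eq_map_formPerm {w : List (Fin N)} (hw : w.Nodup) :
    cyclicSteps w = w.map fun x => stepSign x (w.formPerm x) := by
  rcases w with _ | ⟨a, l⟩
  · rfl
  refine List.ext_getElem (by simp [cyclicSteps]) fun i h1 h2 => ?_
  rw [List.length_map] at h2
  have h3 : (a :: l).formPerm (a :: l)[i] = (l ++ [a])[i]'(by simpa using h2) := by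
    have : l ++ [a] = (a :: l).rotate 1 := by simp
    rw [List.formPerm_apply_getElem _ hw]
    simp only [this, List.getElem_rotate]
  rw [List.getElem_map, h3]
  simp only [cyclicSteps, steps, List.cons_append, List.tail_cons, List.getElem_zipWith]
  congr 1
  simp only [← List.cons_append]
  rw [List.getElem_append_left h2]

theorem card_filter_lt_add_card_filter_gt (c : Equiv.Perm (Fin N)) :
    (c.support.filter fun x => x < c x).card + (c.support.filter fun x => c x < x).card =
      c.support.card := by
  rw [← Finset.card_filter_add_card_filter_not (s := c.support) (fun x => x < c x)]
  congr 2
  apply Finset.filter_congr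
  intro x hx
  have : c x ≠ x := mem_support.1 hx
  rw [not_lt]
  exact ⟨le_of_lt, fun h => lt_of_le_of_ne h this⟩

theorem two_mul_permM_formPerm_add {w : List (Fin N)} (hw : w.Nodup) (h0 : w ≠ []) :
    2 * permM w.formPerm + (cyclicSteps w).sum.natAbs = w.length := by
  rcases w with _ | ⟨a, _ | ⟨b, l⟩⟩
  · exact absurd rfl h0
  · simp [permM, cyclicSteps, stepSign]
  set w := a :: b :: l with hwd
  have hc : w.formPerm.IsCycle := List.isCycle_formPerm hw (by simp [hwd])
  have hs : w.formPerm.support = w.toFinset :=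
    List.support_formPerm_of_nodup w hw (by simp [hwd])
  have hM : permM w.formPerm = cycleM w.formPerm := by
    rw [permM, hc.cycleFactorsFinset_eq_singleton, Finset.sum_singleton]
  have hadd := card_filter_lt_add_card_filter_gt w.formPerm
  have hsum : (cyclicSteps w).sum = 2 * (w.formPerm.support.filter
      fun x => x < w.formPerm x).card - (w.formPerm.support.card : ℤ) := by
    have : ∀ x y : Fin N, stepSign x y = 2 * (if x < y then 1 else 0) - 1 := by
      intro x y; unfold stepSign; split_ifs <;> rfl
    rw [cyclicSteps_eq_map_formPerm hw, ← List.sum_toFinset _ hw, ← hs]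
    simp_rw [this, Finset.sum_sub_distrib, ← Finset.mul_sum, Finset.card_filter]
    simp
  have hlen : w.formPerm.support.card = w.length := by
    rw [hs, List.toFinset_card_of_nodup hw]
  rw [hM, cycleM]
  lia

theorem permM_mul_of_disjoint {σ τ : Equiv.Perm (Fin N)} (h : σ.Disjoint τ) :
    permM (σ * τ) = permM σ + permM τ := by
  rw [permM, h.cycleFactorsFinset_mul_eq_union, Finset.sum_union h.disjoint_cycleFactorsFinset]
  rfl

theorem disjoint_formPerm {u v : List (Fin N)} (h : ∀ x ∈ u, x ∉ v) :
    u.formPerm.Disjoint v.formPerm := by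
  intro x
  by_cases hx : x ∈ u
  · exact Or.inr (List.formPerm_apply_of_notMem (h x hx))
  · exact Or.inl (List.formPerm_apply_of_notMem hx)

theorem exists_orbit_word (σ : Equiv.Perm (Fin N)) (x : Fin N) :
    ∃ w : List (Fin N), w.Nodup ∧ (∀ y, y ∈ w ↔ σ.SameCycle x y) ∧
      (∀ y ∈ w, w.formPerm y = σ y) ∧ w.length ∣ orderOf σ := by
  by_cases hx : σ x = x
  · refine ⟨[x], by simp, fun y => ?_, by simp [hx], by simp⟩
    rw [List.mem_singleton]
    constructor
    · rintro rfl; exact SameCycle.refl _ _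
    · intro h
      exact (h.eq_of_left hx).symm
  · have hxs : x ∈ σ.support := mem_support.2 hx
    refine ⟨σ.toList x, nodup_toList σ x, fun y => ?_, fun y hy => ?_, ?_⟩
    · rw [mem_toList_iff]; simp [hx]
    · rw [formPerm_toList, (mem_toList_iff.1 hy).1.cycleOf_apply]
    · rw [Equiv.Perm.length_toList, ← (isCycle_cycleOf σ hx).orderOf]
      exact orderOf_cycleOf_dvd_orderOf σ x

/-- Letters in pairwise distinct cycles bound `M` of an odd order permutation. -/
theorem two_mul_permM_add_card_le {σ : Equiv.Perm (Fin N)} (hσ : Odd (orderOf σ))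
    {T : Finset (Fin N)} (hT : ∀ x ∈ T, ∀ y ∈ T, σ.SameCycle x y → x = y) :
    2 * permM σ + T.card ≤ N := by
  have hcycle : ∀ c ∈ σ.cycleFactorsFinset, 2 * cycleM c ≤ (c.support \ T).card := by
    intro c hc
    have h1 := card_filter_lt_add_card_filter_gt c
    have h2 : Odd c.support.card := by
      obtain ⟨x, hx⟩ := (mem_cycleFactorsFinset_iff.1 hc).1.nonempty_support
      have h3 : c = σ.cycleOf x := cycle_is_cycleOf hx hc
      rw [← (mem_cycleFactorsFinset_iff.1 hc).1.orderOf, h3]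
      exact hσ.of_dvd_nat (orderOf_cycleOf_dvd_orderOf σ x)
    have h3 : (T ∩ c.support).card ≤ 1 := by
      rw [Finset.card_le_one]
      intro x hx y hy
      rw [Finset.mem_inter] at hx hy
      refine hT x hx.1 y hy.1 ?_
      have := cycle_is_cycleOf hx.2 hc
      rw [this, mem_support_cycleOf_iff] at hy
      exact hy.2.1
    have h4 := Finset.card_sdiff_add_card_inter c.support T
    rw [Finset.inter_comm] at h4
    rw [cycleM]
    grind
  have hsum : ∑ c ∈ σ.cycleFactorsFinset, (c.support \ T).card ≤ (Finset.univ \ T).card := by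
    rw [← Finset.card_biUnion]
    · exact Finset.card_le_card fun x => by simp
    · intro c hc d hd hcd
      exact (Equiv.Perm.Disjoint.disjoint_support
        (cycleFactorsFinset_pairwise_disjoint σ hc hd hcd)).mono
          Finset.sdiff_subset Finset.sdiff_subset
  have h5 : (Finset.univ \ T).card + T.card = N := by
    have := Finset.card_sdiff_add_card_inter (Finset.univ : Finset (Fin N)) T
    simpa using this
  have h6 : 2 * permM σ ≤ ∑ c ∈ σ.cycleFactorsFinset, (c.support \ T).card := by
    rw [permM, Finset.mul_sum]
    exact Finset.sum_le_sum hcycle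
  lia

theorem mem_iff_sameCycle_of_formPerm {σ : Equiv.Perm (Fin N)} {w : List (Fin N)} (hw : w.Nodup)
    (h : ∀ y ∈ w, w.formPerm y = σ y) {x : Fin N} (hx : x ∈ w) (y : Fin N) :
    y ∈ w ↔ σ.SameCycle x y := by
  have hpow : ∀ i : ℕ, (w.formPerm ^ i) x ∈ w ∧ (w.formPerm ^ i) x = (σ ^ i) x := by
    intro i
    induction i with
    | zero => simpa using hx
    | succ i ih =>
      rw [pow_succ', pow_succ', Equiv.Perm.mul_apply, Equiv.Perm.mul_apply, ← ih.2, ← h _ ih.1]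
      exact ⟨List.formPerm_apply_mem_of_mem ih.1, rfl⟩
  constructor
  · intro hy
    obtain ⟨i, rfl⟩ := (hw.isCycleOn_formPerm.2 hx hy).exists_nat_pow_eq
    exact ⟨i, by simpa using (hpow i).2.symm⟩
  · intro hy
    obtain ⟨i, rfl⟩ := hy.exists_nat_pow_eq
    rw [← (hpow i).2]
    exact (hpow i).1

theorem eq_of_formPerm_eq {S : Finset (Fin N)} {w w' : List (Fin N)} (hw : w ∈ dyckWords S)
    (hw' : w' ∈ dyckWords S) (h : w.formPerm = w'.formPerm) : w = w' := by
  rw [mem_dyckWords] at hw hw'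
  obtain ⟨hn, hx⟩ := mem_words.1 hw.1
  obtain ⟨hn', hx'⟩ := mem_words.1 hw'.1
  rcases (List.formPerm_eq_formPerm_iff hn hn').1 h with h | ⟨h1, h2⟩
  · exact hw.2.eq_of_isRotated hw'.2 h
  · rcases w with _ | ⟨a, _ | ⟨b, l⟩⟩
    · exact (List.eq_nil_iff_forall_not_mem.2 fun a ha => by simpa using (hx a).2 ((hx' a).1 ha)).symm
    · have hl := (length_of_mem_words hw'.1).trans (length_of_mem_words hw.1).symm
      obtain ⟨c, rfl⟩ := List.length_eq_one_iff.1 hl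
      have := (hx' a).2 ((hx a).1 (by simp))
      rw [List.mem_singleton.1 this]
    · simp at h1

theorem disjoint_formPerm_of_mem_dyckPairs {S : Finset (Fin N)} {u v : List (Fin N)}
    (h : ⟨S, u, v⟩ ∈ dyckPairs N) : u.formPerm.Disjoint v.formPerm := by
  obtain ⟨-, h2, h3⟩ := mem_dyckPairs.1 h
  refine disjoint_formPerm fun x hx hx' => ?_
  have h4 := ((mem_words.1 (mem_dyckWords.1 h2).1).2 x).1 hx
  have h5 := ((mem_words.1 (mem_dyckWords.1 h3).1).2 x).1 hx'
  exact (Finset.mem_compl.1 h5) h4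

theorem mul_formPerm_apply_of_mem {u v : List (Fin N)} (h : u.formPerm.Disjoint v.formPerm)
    (huv : ∀ x ∈ v, x ∉ u) {y : Fin N} (hy : y ∈ v) :
    v.formPerm y = (u.formPerm * v.formPerm) y := by
  rw [h.commute.eq, Equiv.Perm.mul_apply, List.formPerm_apply_of_notMem (huv y hy)]

theorem odd_orderOf_formPerm_mul {u v : List (Fin N)} (hu : u.Nodup) (hv : v.Nodup)
    (hul : Odd u.length) (hvl : Odd v.length) (h : u.formPerm.Disjoint v.formPerm) :
    Odd (orderOf (u.formPerm * v.formPerm)) := by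
  refine Odd.of_dvd_nat (hul.mul hvl) (h.commute.orderOf_mul_dvd_mul_orderOf.trans ?_)
  exact mul_dvd_mul (orderOf_dvd_of_pow_eq_one (List.formPerm_pow_length_eq_one_of_nodup _ hu))
    (orderOf_dvd_of_pow_eq_one (List.formPerm_pow_length_eq_one_of_nodup _ hv))

theorem exists_dyckPair_of_odd_orderOf {n : ℕ} (hn : 1 ≤ n) (m : Fin (2 * n))
    {σ : Equiv.Perm (Fin (2 * n))} (hσ : Odd (orderOf σ)) (hM : permM σ = n - 1) :
    ∃ S u v, ⟨S, u, v⟩ ∈ dyckPairs (2 * n) ∧ m ∈ v ∧ u.formPerm * v.formPerm = σ := by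
  obtain ⟨v, hvn, hv, hvσ, hvl⟩ := exists_orbit_word σ m
  have hvo : Odd v.length := hσ.of_dvd_nat hvl
  obtain ⟨y, hy⟩ : ∃ y, y ∉ v := by
    by_contra! hall
    have h1 : v.toFinset = Finset.univ := Finset.eq_univ_iff_forall.2 fun x => by simp [hall x]
    have h2 := List.toFinset_card_of_nodup hvn
    rw [h1, Finset.card_univ, Fintype.card_fin] at h2
    grind
  obtain ⟨u, hun, hu, huσ, hul⟩ := exists_orbit_word σ y
  have huo : Odd u.length := hσ.of_dvd_nat hul
  have hmv : m ∈ v := (hv m).2 (SameCycle.refl _ _)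
  have hdisj : ∀ x ∈ u, x ∉ v := fun x hx hx' =>
    hy ((hv y).2 (((hv x).1 hx').trans ((hu x).1 hx).symm))
  have hcover : ∀ z, z ∉ v → z ∈ u := by
    intro z hzv
    by_contra hzu
    have hmy : ¬ σ.SameCycle m y := fun h => hy ((hv y).2 h)
    have hmz : ¬ σ.SameCycle m z := fun h => hzv ((hv z).2 h)
    have hyz : ¬ σ.SameCycle y z := fun h => hzu ((hu z).2 h)
    have hcard : ({m, y, z} : Finset (Fin (2 * n))).card = 3 :=
      Finset.card_eq_three.2 ⟨m, y, z, fun h => hmy (h ▸ SameCycle.refl _ _),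
        fun h => hmz (h ▸ SameCycle.refl _ _), fun h => hyz (h ▸ SameCycle.refl _ _), rfl⟩
    have := two_mul_permM_add_card_le hσ (T := {m, y, z}) (by
      have := fun h : σ.SameCycle y m => hmy h.symm
      have := fun h : σ.SameCycle z m => hmz h.symm
      have := fun h : σ.SameCycle z y => hyz h.symm
      simp only [Finset.mem_insert, Finset.mem_singleton]
      rintro a (rfl | rfl | rfl) b (rfl | rfl | rfl) h <;> first | rfl | contradiction)
    lia
  have hdp := disjoint_formPerm hdisj
  have hprod : u.formPerm * v.formPerm = σ := by
    ext1 x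
    by_cases hx : x ∈ v
    · rw [← mul_formPerm_apply_of_mem hdp (fun a ha ha' => hdisj a ha' ha) hx, hvσ x hx]
    · rw [Equiv.Perm.mul_apply, List.formPerm_apply_of_notMem hx, huσ x (hcover x hx)]
  have hlen : u.length + v.length = 2 * n := by
    have h1 : v.toFinsetᶜ = u.toFinset := by
      ext x
      simp only [Finset.mem_compl, List.mem_toFinset]
      exact ⟨hcover x, hdisj x⟩
    have h2 := Finset.card_add_card_compl v.toFinset
    rw [h1, List.toFinset_card_of_nodup hvn, List.toFinset_card_of_nodup hun,
      Fintype.card_fin] at h2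
    lia
  have hu0 : u ≠ [] := by rintro rfl; simp at huo
  have hv0 : v ≠ [] := List.ne_nil_of_mem hmv
  have hMu := two_mul_permM_formPerm_add hun hu0
  have hMv := two_mul_permM_formPerm_add hvn hv0
  rw [← hprod, permM_mul_of_disjoint hdp] at hM
  obtain ⟨u', hu', hdu⟩ := exists_isDyckWord_of_natAbs_sum hun (by grind)
  obtain ⟨v', hv', hdv⟩ := exists_isDyckWord_of_natAbs_sum hvn (by grind)
  refine ⟨u.toFinset, u', v', mem_dyckPairs.2 ⟨?_, ?_, ?_⟩, hv'.mem_iff.1 hmv, ?_⟩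
  · rwa [List.toFinset_card_of_nodup hun]
  · exact mem_dyckWords.2 ⟨mem_words_of_isRotated (mem_words.2 ⟨hun, by simp⟩) hu', hdu⟩
  · refine mem_dyckWords.2 ⟨mem_words_of_isRotated (mem_words.2 ⟨hvn, fun x => ?_⟩) hv', hdv⟩
    simp only [Finset.mem_compl, List.mem_toFinset]
    exact ⟨fun h h' => hdisj x h' h, fun h => by_contra fun h' => h (hcover x h')⟩
  · rw [← List.formPerm_eq_of_isRotated hun hu', ← List.formPerm_eq_of_isRotated hvn hv', hprod]

theorem card_dyckPairs_filter_mem {n : ℕ} (hn : 1 ≤ n) (m : Fin (2 * n)) :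
    ((dyckPairs (2 * n)).filter fun x => m ∈ x.2.2).card = pCount (2 * n) (n - 1) := by
  refine Finset.card_bij (fun x _ => x.2.1.formPerm * x.2.2.formPerm) ?_ ?_ ?_
  · rintro ⟨S, u, v⟩ h
    obtain ⟨h, -⟩ := Finset.mem_filter.1 h
    have hdp := disjoint_formPerm_of_mem_dyckPairs h
    obtain ⟨hu0, hv0⟩ := ne_nil_of_mem_dyckPairs h
    obtain ⟨h1, h2, h3⟩ := mem_dyckPairs.1 h
    dsimp only at h1 h2 h3 ⊢
    rw [mem_dyckWords] at h2 h3
    have hun := (mem_words.1 h2.1).1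
    have hvn := (mem_words.1 h3.1).1
    have hul := length_of_mem_words h2.1
    have hvl := length_of_mem_words h3.1
    have hcompl := Finset.card_add_card_compl S
    rw [Fintype.card_fin] at hcompl
    refine Finset.mem_filter.2 ⟨Finset.mem_univ _, ?_, ?_⟩
    · exact odd_orderOf_formPerm_mul hun hvn (hul ▸ h1) (hvl ▸ card_compl_odd h1) hdp
    · have hMu := two_mul_permM_formPerm_add hun hu0
      have hMv := two_mul_permM_formPerm_add hvn hv0
      rw [h2.2.natAbs_sum_cyclicSteps hu0] at hMu
      rw [h3.2.natAbs_sum_cyclicSteps hv0] at hMv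
      rw [permM_mul_of_disjoint hdp]
      lia
  · rintro ⟨S, u, v⟩ h ⟨S', u', v'⟩ h' heq
    obtain ⟨h, hm⟩ := Finset.mem_filter.1 h
    obtain ⟨h', hm'⟩ := Finset.mem_filter.1 h'
    have hdp := disjoint_formPerm_of_mem_dyckPairs h
    have hdp' := disjoint_formPerm_of_mem_dyckPairs h'
    obtain ⟨-, h2, h3⟩ := mem_dyckPairs.1 h
    obtain ⟨-, h2', h3'⟩ := mem_dyckPairs.1 h'
    dsimp only at h2 h3 h2' h3' heq hm hm'
    obtain ⟨-, hu⟩ := mem_words.1 (mem_dyckWords.1 h2).1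
    obtain ⟨-, hu'⟩ := mem_words.1 (mem_dyckWords.1 h2').1
    obtain ⟨hvn, hv⟩ := mem_words.1 (mem_dyckWords.1 h3).1
    obtain ⟨hvn', hv'⟩ := mem_words.1 (mem_dyckWords.1 h3').1
    have hvu : ∀ x ∈ v, x ∉ u := fun x hx hx' =>
      Finset.mem_compl.1 ((hv x).1 hx) ((hu x).1 hx')
    have hvu' : ∀ x ∈ v', x ∉ u' := fun x hx hx' =>
      Finset.mem_compl.1 ((hv' x).1 hx) ((hu' x).1 hx')
    have hσ : ∀ y ∈ v, v.formPerm y = (u.formPerm * v.formPerm) y := fun y hy =>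
      mul_formPerm_apply_of_mem hdp hvu hy
    have hσ' : ∀ y ∈ v', v'.formPerm y = (u.formPerm * v.formPerm) y := fun y hy => by
      rw [heq]
      exact mul_formPerm_apply_of_mem hdp' hvu' hy
    have hvv : ∀ y, y ∈ v ↔ y ∈ v' := fun y => by
      rw [mem_iff_sameCycle_of_formPerm hvn hσ hm, mem_iff_sameCycle_of_formPerm hvn' hσ' hm']
    obtain rfl : S = S' := by
      rw [← compl_inj_iff]
      ext y
      rw [← hv, ← hv', hvv]
    have hfv : v.formPerm = v'.formPerm := by
      ext1 y
      by_cases hy : y ∈ v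
      · rw [hσ y hy, hσ' y ((hvv y).1 hy)]
      · rw [List.formPerm_apply_of_notMem hy,
          List.formPerm_apply_of_notMem fun h => hy ((hvv y).2 h)]
    obtain rfl := eq_of_formPerm_eq h3 h3' hfv
    obtain rfl := eq_of_formPerm_eq h2 h2' (mul_right_cancel heq)
    rfl
  · intro σ hσ
    obtain ⟨-, ho, hM⟩ := Finset.mem_filter.1 hσ
    obtain ⟨S, u, v, h, hm, hσ⟩ := exists_dyckPair_of_odd_orderOf hn m ho hM
    exact ⟨⟨S, u, v⟩, Finset.mem_filter.2 ⟨h, hm⟩, hσ⟩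

theorem card_dyckPairs_eq_two_mul_pCount {n : ℕ} (hn : 1 ≤ n) :
    (dyckPairs (2 * n)).card = 2 * pCount (2 * n) (n - 1) := by
  let m : Fin (2 * n) := ⟨0, by lia⟩
  rw [← card_dyckPairs_filter_mem hn m,
    ← Finset.card_filter_add_card_filter_not (s := dyckPairs (2 * n)) (fun x => m ∈ x.2.2),
    two_mul (Finset.card _), Nat.add_left_cancel_iff]
  have hmem : ∀ x ∈ dyckPairs (2 * n), (⟨x.1ᶜ, x.2.2, x.2.1⟩ :
      Σ _ : Finset (Fin (2 * n)), List (Fin (2 * n)) × List (Fin (2 * n))) ∈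
        dyckPairs (2 * n) ∧ (m ∈ x.2.1 ↔ m ∉ x.2.2) := by
    intro x hx
    obtain ⟨h1, h2, h3⟩ := mem_dyckPairs.1 hx
    refine ⟨mem_dyckPairs.2 ⟨card_compl_odd h1, h3, by simpa using h2⟩, ?_⟩
    rw [(mem_words.1 (mem_dyckWords.1 h2).1).2, (mem_words.1 (mem_dyckWords.1 h3).1).2,
      Finset.mem_compl, not_not]
  refine Finset.card_nbij' (fun x => ⟨x.1ᶜ, x.2.2, x.2.1⟩) (fun x => ⟨x.1ᶜ, x.2.2, x.2.1⟩)
    ?_ ?_ (fun x _ => by simp) (fun x _ => by simp)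
  all_goals
    intro x hx
    rw [Finset.mem_coe, Finset.mem_filter] at hx ⊢
    obtain ⟨h1, h2⟩ := hmem x hx.1
    have := hx.2
    exact ⟨h1, by tauto⟩

end OddOrder

theorem ballot_eq_odd_order_even_max_descents (n : ℕ) (hn : 1 ≤ n) :
    bCount (2 * n) (n - 1) = pCount (2 * n) (n - 1) ∧
      (bCount (2 * n) (n - 1) : ℚ) =
        (1 / 2) * ∑ k ∈ (Finset.range (2 * n)).filter (fun k => Odd k),
          ((2 * n).choose k : ℚ) * eulerianCatalan ((k - 1) / 2) *
            eulerianCatalan ((2 * n - k - 1) / 2) := by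
  have hb := card_dyckPairs_eq_two_mul_bCount hn
  have hp := card_dyckPairs_eq_two_mul_pCount hn
  refine ⟨by lia, ?_⟩
  have h : (2 * bCount (2 * n) (n - 1) : ℚ) =
      ∑ k ∈ (Finset.range (2 * n)).filter (fun k => Odd k),
        ((2 * n).choose k : ℚ) * eulerianCatalan ((k - 1) / 2) *
          eulerianCatalan ((2 * n - k - 1) / 2) := by
    rw [card_dyckPairs] at hb
    exact_mod_cast hb.symm
  rw [← h]
  ring
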